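/- arXiv:0904.0990 — 2 statements merged into one kernel-verified Lean document; each statement's English description precedes it below -/
import Mathlib

section
/- Let n ≥ 3 and let f : ℝⁿ → ℝ be a C² function whose graph has negative Ricci curvature at every point, i.e. for every x ∈ ℝⁿ, every eigenvalue k of W(x) satisfies k·(tr W(x) − k) < 0. Then inf_{x∈ℝⁿ} |A|(x) = 0, where |A|(x) = √(tr(W(x)²)); equivalently, for every ε > 0 there exists x ∈ ℝⁿ with |A|(x) < ε. -/
open Metric Finset

/-- Coordinates of the gradient of `f` at `x`. -/
noncomputable def grad (n : ℕ) (f : EuclideanSpace ℝ (Fin n) → ℝ)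
    (x : EuclideanSpace ℝ (Fin n)) : Fin n → ℝ :=
  fun i => fderiv ℝ f x (EuclideanSpace.single i 1)

/-- The Hessian matrix `D²f(x)`. -/
noncomputable def hess (n : ℕ) (f : EuclideanSpace ℝ (Fin n) → ℝ)
    (x : EuclideanSpace ℝ (Fin n)) : Matrix (Fin n) (Fin n) ℝ :=
  Matrix.of fun i j =>
    fderiv ℝ (fun y => fderiv ℝ f y (EuclideanSpace.single j 1)) x (EuclideanSpace.single i 1)

/-- `|∇f(x)|²`. -/
noncomputable def gradSq (n : ℕ) (f : EuclideanSpace ℝ (Fin n) → ℝ)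
    (x : EuclideanSpace ℝ (Fin n)) : ℝ :=
  ∑ i, grad n f x i ^ 2

/-- The shape operator of the graph of `f`, with respect to the upward unit normal:
`W(x) = (1+|∇f|²)^{-1/2} (Iₙ - ∇f ∇fᵀ/(1+|∇f|²)) D²f(x)`. -/
noncomputable def shapeOp (n : ℕ) (f : EuclideanSpace ℝ (Fin n) → ℝ)
    (x : EuclideanSpace ℝ (Fin n)) : Matrix (Fin n) (Fin n) ℝ :=
  (Real.sqrt (1 + gradSq n f x))⁻¹ •
    (((1 : Matrix (Fin n) (Fin n) ℝ) -
      Matrix.of fun i j => grad n f x i * grad n f x j / (1 + gradSq n f x)) * hess n f x)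

/-- The mean curvature `H(x) = tr W(x) / n`. -/
noncomputable def meanCurv (n : ℕ) (f : EuclideanSpace ℝ (Fin n) → ℝ)
    (x : EuclideanSpace ℝ (Fin n)) : ℝ :=
  (shapeOp n f x).trace / n

/-- The scalar curvature `R(x) = ((tr W)² - tr(W²)) / (n(n-1))`. -/
noncomputable def scalarCurv (n : ℕ) (f : EuclideanSpace ℝ (Fin n) → ℝ)
    (x : EuclideanSpace ℝ (Fin n)) : ℝ :=
  ((shapeOp n f x).trace ^ 2 - (shapeOp n f x * shapeOp n f x).trace) /
    ((n : ℝ) * ((n : ℝ) - 1))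

/-- The length `|A|(x) = √(tr(W(x)²))` of the second fundamental form. -/
noncomputable def normA (n : ℕ) (f : EuclideanSpace ℝ (Fin n) → ℝ)
    (x : EuclideanSpace ℝ (Fin n)) : ℝ :=
  Real.sqrt ((shapeOp n f x * shapeOp n f x).trace)

/-- `e` is an orthonormal basis of eigenvectors of the symmetric matrix `B`, with eigenvalues `l`,
in dot-product form. -/
structure IsDiagonalization {n : ℕ} (B : Matrix (Fin n) (Fin n) ℝ) (l : Fin n → ℝ)
    (e : Fin n → Fin n → ℝ) : Prop where
  orthonormal : ∀ i j, e i ⬝ᵥ e j = if i = j then 1 else 0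
  mulVec_eq : ∀ i, B.mulVec (e i) = l i • e i
  norm_sq : ∀ v, v ⬝ᵥ v = ∑ i, (e i ⬝ᵥ v) ^ 2
  quadratic : ∀ v, v ⬝ᵥ B.mulVec v = ∑ i, l i * (e i ⬝ᵥ v) ^ 2
  trace_eq : B.trace = ∑ i, l i
  trace_mul_self : (B * B).trace = ∑ i, l i ^ 2

theorem Matrix.IsSymm.exists_diagonalization {n : ℕ} {B : Matrix (Fin n) (Fin n) ℝ}
    (hB : B.IsSymm) : ∃ l e, IsDiagonalization B l e := by
  have hH : B.IsHermitian := by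
    rw [Matrix.IsHermitian, Matrix.conjTranspose_eq_transpose_of_trivial]; exact hB
  have hinner : ∀ a b : Fin n → ℝ, inner ℝ (WithLp.toLp 2 a) (WithLp.toLp 2 b) = a ⬝ᵥ b := by
    intro a b
    rw [EuclideanSpace.inner_toLp_toLp, star_trivial, dotProduct_comm]
  set e : Fin n → Fin n → ℝ := fun i => (hH.eigenvectorBasis i).ofLp with he
  have hee : ∀ i, hH.eigenvectorBasis i = WithLp.toLp 2 (e i) := fun i => rfl
  have heig : ∀ i, B.mulVec (e i) = hH.eigenvalues i • e i := fun i =>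
    hH.mulVec_eigenvectorBasis i
  have hpars : ∀ a b : Fin n → ℝ, a ⬝ᵥ b = ∑ i, (e i ⬝ᵥ a) * (e i ⬝ᵥ b) := by
    intro a b
    have h := hH.eigenvectorBasis.sum_inner_mul_inner (WithLp.toLp 2 a) (WithLp.toLp 2 b)
    simp only [hee, hinner] at h
    rw [← h]
    exact Finset.sum_congr rfl fun i _ => by rw [dotProduct_comm a]
  have hBe : ∀ i v, e i ⬝ᵥ B.mulVec v = hH.eigenvalues i * (e i ⬝ᵥ v) := by
    intro i v
    rw [Matrix.dotProduct_mulVec, ← Matrix.mulVec_transpose, hB.eq, heig, smul_dotProduct,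
      smul_eq_mul]
  have horth : ∀ i j, e i ⬝ᵥ e j = if i = j then 1 else 0 := by
    intro i j
    rw [← hinner, ← hee, ← hee]
    exact orthonormal_iff_ite.mp hH.eigenvectorBasis.orthonormal i j
  refine ⟨hH.eigenvalues, e, horth, heig, ?_, ?_, ?_, ?_⟩
  · intro v
    rw [hpars]
    exact Finset.sum_congr rfl fun i _ => by ring
  · intro v
    rw [hpars]
    exact Finset.sum_congr rfl fun i _ => by rw [hBe]; ring
  · simpa using hH.trace_eq_sum_eigenvalues
  · have hcol : ∀ j, (B * B) j j = ∑ i, hH.eigenvalues i ^ 2 * e i j ^ 2 := by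
      intro j
      have h1 : (B * B) j j = B.mulVec (Pi.single j 1) ⬝ᵥ B.mulVec (Pi.single j 1) := by
        simp only [Matrix.mul_apply, dotProduct, Matrix.mulVec_single_one, Matrix.col_apply]
        exact Finset.sum_congr rfl fun i _ => by rw [hB.apply]
      rw [h1, hpars]
      refine Finset.sum_congr rfl fun i _ => ?_
      rw [hBe, dotProduct_single_one]; ring
    rw [Matrix.trace]
    simp only [Matrix.diag_apply, hcol]
    rw [Finset.sum_comm]
    refine Finset.sum_congr rfl fun i _ => ?_
    rw [← Finset.mul_sum]
    have := horth i i
    simp only [dotProduct, if_true] at this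
    simp only [pow_two (e i _), this, mul_one]

/-- If the sums obtained from `∑ i, l i` by deleting either of two entries are positive, an upper
bound on the entries controls the sum of squares. -/
theorem sum_sq_le_of_sub_pos {n : ℕ} {l : Fin n → ℝ} {d : ℝ} {i j : Fin n} (hij : i ≠ j)
    (hi : 0 < ∑ k, l k - l i) (hj : 0 < ∑ k, l k - l j) (hd : 0 ≤ d) (hl : ∀ k, l k ≤ d) :
    ∑ k, l k ^ 2 ≤ n * (n * d) ^ 2 := by
  have hn : (1 : ℝ) ≤ n := by exact_mod_cast Fin.pos i
  have key : ∀ a b : Fin n, b ≠ a → 0 < ∑ k, l k - l a → -(n * d) ≤ l b := by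
    intro a b hab h
    rw [← Finset.add_sum_erase _ _ (Finset.mem_univ a), add_sub_cancel_left,
      ← Finset.add_sum_erase _ _ (Finset.mem_erase.mpr ⟨hab, Finset.mem_univ b⟩)] at h
    have h2 : ∑ k ∈ (univ.erase a).erase b, l k ≤ ∑ _k : Fin n, d :=
      (Finset.sum_le_sum fun k _ => hl k).trans
        (Finset.sum_le_sum_of_subset_of_nonneg (Finset.subset_univ _) fun _ _ _ => hd)
    simp only [Finset.sum_const, Finset.card_univ, Fintype.card_fin, nsmul_eq_mul] at h2
    linarith
  have hb : ∀ k, l k ^ 2 ≤ (n * d) ^ 2 := by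
    intro k
    refine sq_le_sq' ?_ ((hl k).trans (le_mul_of_one_le_left hd hn))
    by_cases hk : k = i
    · exact key j k (hk ▸ hij) hj
    · exact key i k hk hi
  calc ∑ k, l k ^ 2 ≤ ∑ _k : Fin n, (n * d) ^ 2 := Finset.sum_le_sum fun k _ => hb k
    _ = n * (n * d) ^ 2 := by simp

/-- A symmetric form which is at most `-μ` on a plane spanned by two eigenvectors cannot be close
to one which is at least `ν` on a hyperplane spanned by eigenvectors. -/
theorem not_close_of_two_neg {n : ℕ} {B C : Matrix (Fin n) (Fin n) ℝ}
    {l m : Fin n → ℝ} {e g : Fin n → Fin n → ℝ} {μ ν : ℝ}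
    (hB : IsDiagonalization B l e) (hC : IsDiagonalization C m g)
    {i j k : Fin n} (hij : i ≠ j) (hi : l i ≤ -μ) (hj : l j ≤ -μ) (hm : ∀ a, a ≠ k → ν ≤ m a)
    (hclose : ∀ v, v ≠ 0 → v ⬝ᵥ C.mulVec v - v ⬝ᵥ B.mulVec v < (μ + ν) * (v ⬝ᵥ v)) :
    False := by
  obtain ⟨s, t, hst, hk⟩ : ∃ s t : ℝ, 0 < s ^ 2 + t ^ 2 ∧
      s * (g k ⬝ᵥ e i) + t * (g k ⬝ᵥ e j) = 0 := by
    by_cases h : g k ⬝ᵥ e i = 0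
    · exact ⟨1, 0, by norm_num, by simp [h]⟩
    · exact ⟨-(g k ⬝ᵥ e j), g k ⬝ᵥ e i, by positivity, by ring⟩
  set v : Fin n → ℝ := s • e i + t • e j with hv
  have hev : ∀ a, e a ⬝ᵥ v = s * (if a = i then 1 else 0) + t * (if a = j then 1 else 0) := by
    intro a; simp [hv, dotProduct_add, dotProduct_smul, hB.orthonormal]
  have hvv : v ⬝ᵥ v = s ^ 2 + t ^ 2 := by
    nth_rewrite 1 [hv]
    rw [add_dotProduct, smul_dotProduct, smul_dotProduct, hev, hev]
    simp [hij, hij.symm]; ring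
  have hBv : v ⬝ᵥ B.mulVec v ≤ -μ * (v ⬝ᵥ v) := by
    have : v ⬝ᵥ B.mulVec v = l i * s ^ 2 + l j * t ^ 2 := by
      rw [hB.quadratic, ← Finset.sum_subset (Finset.subset_univ {i, j}), Finset.sum_pair hij]
      · simp [hev, hij, hij.symm]
      · intro a _ ha
        simp only [Finset.mem_insert, Finset.mem_singleton, not_or] at ha
        simp [hev, ha.1, ha.2]
    rw [this, hvv]
    nlinarith [mul_le_mul_of_nonneg_right hi (sq_nonneg s),
      mul_le_mul_of_nonneg_right hj (sq_nonneg t)]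
  have hCv : ν * (v ⬝ᵥ v) ≤ v ⬝ᵥ C.mulVec v := by
    rw [hC.quadratic, hC.norm_sq, Finset.mul_sum]
    refine Finset.sum_le_sum fun a _ => ?_
    by_cases ha : a = k
    · have : g k ⬝ᵥ v = 0 := by
        rw [hv, dotProduct_add, dotProduct_smul, dotProduct_smul]; simpa using hk
      simp [ha, this]
    · exact mul_le_mul_of_nonneg_right (hm a ha) (sq_nonneg _)
  have hv0 : v ≠ 0 := by
    intro h0; rw [h0] at hvv; simp at hvv; linarith
  have := hclose v hv0
  linarith

theorem abs_dotProduct_mulVec_le {n : ℕ} (M : Matrix (Fin n) (Fin n) ℝ) (v : Fin n → ℝ) :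
    |v ⬝ᵥ M.mulVec v| ≤ (∑ i, ∑ j, |M i j|) * (v ⬝ᵥ v) := by
  have hle : ∀ i, v i ^ 2 ≤ v ⬝ᵥ v := fun i => by
    rw [dotProduct, pow_two]
    exact Finset.single_le_sum (f := fun i => v i * v i) (fun a _ => mul_self_nonneg _)
      (Finset.mem_univ i)
  have h2 : ∀ i j, |v i * (M i j * v j)| ≤ |M i j| * (v ⬝ᵥ v) := by
    intro i j
    have h3 : |v i| * |v j| ≤ v ⬝ᵥ v := by
      nlinarith [hle i, hle j, sq_abs (v i), sq_abs (v j), sq_nonneg (|v i| - |v j|)]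
    calc |v i * (M i j * v j)| = |M i j| * (|v i| * |v j|) := by rw [abs_mul, abs_mul]; ring
      _ ≤ _ := mul_le_mul_of_nonneg_left h3 (abs_nonneg _)
  simp only [dotProduct.eq_1 v (M.mulVec v), Matrix.mulVec, dotProduct.eq_1 (fun j => M _ j) v,
    Finset.mul_sum, Finset.sum_mul]
  refine (Finset.abs_sum_le_sum_abs _ _).trans (Finset.sum_le_sum fun i _ => ?_)
  exact (Finset.abs_sum_le_sum_abs _ _).trans (Finset.sum_le_sum fun j _ => h2 i j)

theorem nonpos_of_isLocalMax_of_hasDerivAt {φ ψ : ℝ → ℝ} {c : ℝ}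
    (hφ : ∀ᶠ t in nhds 0, HasDerivAt φ (ψ t) t) (hψ : HasDerivAt ψ c 0)
    (hmax : IsLocalMax φ 0) : c ≤ 0 := by
  by_contra! hc
  have hd : deriv φ =ᶠ[nhds 0] ψ := hφ.mono fun t ht => ht.deriv
  have hmin : IsLocalMin φ 0 := by
    refine isLocalMin_of_deriv_deriv_pos ?_ hmax.deriv_eq_zero hφ.self_of_nhds.continuousAt
    rw [hd.deriv_eq, hψ.deriv]; exact hc
  have hconst : φ =ᶠ[nhds 0] fun _ => φ 0 := by
    filter_upwards [hmin, hmax] with t h1 h2 using le_antisymm h2 h1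
  have h0 : ψ =ᶠ[nhds 0] fun _ => 0 := by
    filter_upwards [hd, hconst.eventuallyEq_nhds] with t h1 h2
    rw [← h1, h2.deriv_eq, deriv_const]
  have := h0.deriv_eq
  rw [hψ.deriv, deriv_const] at this
  exact hc.ne' this

/-- A differentiable function plus the height of a hemisphere attains its maximum over the closed
ball at an interior point. -/
theorem exists_isLocalMax_add_hemisphere {n : ℕ} {f : EuclideanSpace ℝ (Fin n) → ℝ}
    (hf : Differentiable ℝ f) {r : ℝ} (hr : 0 < r) :
    ∃ x, ‖x‖ < r ∧ IsLocalMax (fun y => f y + √(r ^ 2 - ‖y‖ ^ 2)) x := by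
  obtain ⟨x, hx, hmax⟩ := (isCompact_closedBall (0 : EuclideanSpace ℝ (Fin n)) r).exists_isMaxOn
    (f := fun y => f y + √(r ^ 2 - ‖y‖ ^ 2)) ⟨0, by simp [hr.le]⟩
    (hf.continuous.add (by fun_prop)).continuousOn
  rw [mem_closedBall_zero_iff] at hx
  have hlt : ‖x‖ < r := by
    refine lt_of_le_of_ne hx fun hxr => ?_
    have hd : HasDerivAt (fun t : ℝ => f ((1 - t) • x)) (fderiv ℝ f x (-x)) 0 := by
      have h1 : HasDerivAt (fun t : ℝ => (1 - t) • x) (-x) 0 := by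
        simpa using ((hasDerivAt_id (0 : ℝ)).const_sub 1).smul_const x
      have h2 : HasFDerivAt f (fderiv ℝ f x) ((1 - (0 : ℝ)) • x) := by
        simpa using (hf x).hasFDerivAt
      exact h2.comp_hasDerivAt 0 h1
    obtain ⟨C, hC⟩ := hd.isBigO_sub.bound
    have hC' : ∀ᶠ t in nhdsWithin (0 : ℝ) (Set.Ioi 0), |f ((1 - t) • x) - f x| ≤ C * |t| := by
      refine Filter.Eventually.filter_mono nhdsWithin_le_nhds ?_
      simpa using hC
    have hsmall : ∀ᶠ t : ℝ in nhdsWithin (0 : ℝ) (Set.Ioi 0), C ^ 2 * t < r ^ 2 := by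
      refine nhdsWithin_le_nhds ?_
      have : ContinuousAt (fun t : ℝ => C ^ 2 * t) 0 := by fun_prop
      exact this.eventually_lt continuousAt_const (by simpa using by positivity)
    have hone : ∀ᶠ t : ℝ in nhdsWithin (0 : ℝ) (Set.Ioi 0), t < 1 :=
      nhdsWithin_le_nhds (Iio_mem_nhds one_pos)
    obtain ⟨t, htC, hts, ht1, ht0⟩ :=
      (hC'.and (hsmall.and (hone.and self_mem_nhdsWithin))).exists
    have ht0 : 0 < t := ht0
    have hnorm : ‖(1 - t) • x‖ = (1 - t) * r := by
      rw [norm_smul, Real.norm_of_nonneg (by linarith), hxr]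
    have hle := hmax (a := (1 - t) • x) (by
      rw [mem_closedBall_zero_iff, hnorm]; nlinarith)
    simp only [Set.mem_ofPred_eq, hnorm, hxr, sub_self, Real.sqrt_zero, add_zero] at hle
    rw [abs_of_pos ht0] at htC
    have h1 : √(r ^ 2 - ((1 - t) * r) ^ 2) ≤ C * t := by
      have := (abs_le.mp htC).1
      linarith
    have h2 := Real.sqrt_le_iff.mp h1
    have h3 : r ^ 2 * t ≤ (C * t) ^ 2 := by
      nlinarith [mul_pos ht0 (sub_pos.mpr ht1), sq_pos_of_pos hr,
        mul_pos (sq_pos_of_pos hr) (mul_pos ht0 (sub_pos.mpr ht1))]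
    nlinarith
  refine ⟨x, hlt, ?_⟩
  filter_upwards [isOpen_ball.mem_nhds (mem_ball_zero_iff.mpr hlt)] with y hy
    using hmax (ball_subset_closedBall hy)

theorem fderiv_eq_dotProduct_grad {n : ℕ} (f : EuclideanSpace ℝ (Fin n) → ℝ)
    (x : EuclideanSpace ℝ (Fin n)) (u : Fin n → ℝ) :
    fderiv ℝ f x (WithLp.toLp 2 u) = grad n f x ⬝ᵥ u := by
  have hu : WithLp.toLp 2 u = ∑ i, u i • EuclideanSpace.single i (1 : ℝ) := by
    ext j; simp [Pi.single_apply]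
  rw [hu, map_sum]
  simp only [map_smul, smul_eq_mul, dotProduct, grad]
  exact Finset.sum_congr rfl fun i _ => mul_comm _ _

theorem hess_apply {n : ℕ} {f : EuclideanSpace ℝ (Fin n) → ℝ} (hf : ContDiff ℝ 2 f)
    (x : EuclideanSpace ℝ (Fin n)) (i j : Fin n) :
    hess n f x i j =
      fderiv ℝ (fderiv ℝ f) x (EuclideanSpace.single i 1) (EuclideanSpace.single j 1) := by
  have hd : DifferentiableAt ℝ (fderiv ℝ f) x :=
    ((hf.fderiv_right (m := 1) (by norm_num)).differentiable (by norm_num)) x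
  simp [hess, fderiv_clm_apply hd (differentiableAt_const _)]

theorem hess_isSymm {n : ℕ} {f : EuclideanSpace ℝ (Fin n) → ℝ} (hf : ContDiff ℝ 2 f)
    (x : EuclideanSpace ℝ (Fin n)) : (hess n f x).IsSymm := by
  refine Matrix.IsSymm.ext fun i j => ?_
  rw [hess_apply hf, hess_apply hf]
  exact (hf.contDiffAt.isSymmSndFDerivAt (by simp)).eq _ _

theorem continuous_hess {n : ℕ} {f : EuclideanSpace ℝ (Fin n) → ℝ} (hf : ContDiff ℝ 2 f) :
    Continuous (hess n f) := by
  refine continuous_matrix fun i j => ?_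
  simp only [hess_apply hf]
  have := (hf.fderiv_right (m := 1) (by norm_num)).continuous_fderiv (by norm_num)
  fun_prop

theorem continuous_grad {n : ℕ} {f : EuclideanSpace ℝ (Fin n) → ℝ} (hf : ContDiff ℝ 2 f) :
    Continuous (grad n f) := by
  have := hf.continuous_fderiv (by norm_num)
  unfold grad
  fun_prop

theorem hasDerivAt_grad_dotProduct {n : ℕ} {f : EuclideanSpace ℝ (Fin n) → ℝ}
    (hf : ContDiff ℝ 2 f) (x : EuclideanSpace ℝ (Fin n)) (u : Fin n → ℝ) :
    HasDerivAt (fun t : ℝ => grad n f (x + t • WithLp.toLp 2 u) ⬝ᵥ u)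
      (u ⬝ᵥ (hess n f x).mulVec u) 0 := by
  have hline : HasDerivAt (fun t : ℝ => x + t • WithLp.toLp 2 u) (WithLp.toLp 2 u) 0 := by
    simpa using ((hasDerivAt_id (0 : ℝ)).smul_const (WithLp.toLp 2 u)).const_add x
  have key : ∀ j, HasDerivAt (fun t : ℝ => grad n f (x + t • WithLp.toLp 2 u) j)
      (∑ i, hess n f x i j * u i) 0 := by
    intro j
    have hd : DifferentiableAt ℝ (fun y => fderiv ℝ f y (EuclideanSpace.single j (1 : ℝ)))
        (x + (0 : ℝ) • WithLp.toLp 2 u) := by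
      have : Differentiable ℝ (fderiv ℝ f) :=
        (hf.fderiv_right (m := 1) (by norm_num)).differentiable (by norm_num)
      fun_prop
    have h := hd.hasFDerivAt.comp_hasDerivAt 0 hline
    rw [fderiv_eq_dotProduct_grad, zero_smul, add_zero] at h
    exact h
  have hs := HasDerivAt.fun_sum (u := Finset.univ) fun j _ => (key j).mul_const (u j)
  refine hs.congr_deriv ?_
  rw [Matrix.dotProduct_mulVec, ← Matrix.mulVec_transpose]
  rfl

theorem exists_hess_le_of_hemisphere {n : ℕ} {f : EuclideanSpace ℝ (Fin n) → ℝ}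
    (hf : ContDiff ℝ 2 f) {r : ℝ} (hr : 0 < r) :
    ∃ x, ∀ u, u ⬝ᵥ (hess n f x).mulVec u ≤
      √(1 + gradSq n f x) / r * (u ⬝ᵥ u + (grad n f x ⬝ᵥ u) ^ 2) := by
  obtain ⟨x, hxr, hmax⟩ := exists_isLocalMax_add_hemisphere (hf.differentiable (by norm_num)) hr
  refine ⟨x, ?_⟩
  have hpos : 0 < r ^ 2 - ‖x‖ ^ 2 := by nlinarith [norm_nonneg x]
  set s := √(r ^ 2 - ‖x‖ ^ 2) with hs
  have hs0 : 0 < s := Real.sqrt_pos.mpr hpos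
  have hs2 : s ^ 2 = r ^ 2 - ‖x‖ ^ 2 := Real.sq_sqrt hpos.le
  have main : ∀ u : Fin n → ℝ, grad n f x ⬝ᵥ u = (x.ofLp ⬝ᵥ u) / s ∧
      u ⬝ᵥ (hess n f x).mulVec u - ((u ⬝ᵥ u) / s + (x.ofLp ⬝ᵥ u) ^ 2 / s ^ 3) ≤ 0 := by
    intro u
    set a := x.ofLp ⬝ᵥ u with ha
    set b := u ⬝ᵥ u with hb
    set q : ℝ → ℝ := fun t => r ^ 2 - ‖x‖ ^ 2 - 2 * t * a - t ^ 2 * b with hq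
    have hq0 : q 0 = s ^ 2 := by simp [hq, hs2]
    have hqn : ∀ t : ℝ, r ^ 2 - ‖x + t • WithLp.toLp 2 u‖ ^ 2 = q t := by
      intro t
      simp only [hq, EuclideanSpace.real_norm_sq_eq, ha, hb, dotProduct, Finset.mul_sum,
        sub_sub, ← Finset.sum_add_distrib]
      congr 1
      exact Finset.sum_congr rfl fun i _ => by simp; ring
    have hqd : ∀ t, HasDerivAt q (-2 * a - 2 * t * b) t := by
      intro t
      have := ((((hasDerivAt_id t).const_mul 2).mul_const a).const_sub (r ^ 2 - ‖x‖ ^ 2)).sub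
        (((hasDerivAt_id t).pow 2).mul_const b)
      refine this.congr_deriv ?_
      simp
    have hfd : ∀ t : ℝ, HasDerivAt (fun t : ℝ => f (x + t • WithLp.toLp 2 u))
        (grad n f (x + t • WithLp.toLp 2 u) ⬝ᵥ u) t := by
      intro t
      have hline : HasDerivAt (fun t : ℝ => x + t • WithLp.toLp 2 u) (WithLp.toLp 2 u) t := by
        simpa using ((hasDerivAt_id t).smul_const (WithLp.toLp 2 u)).const_add x
      rw [← fderiv_eq_dotProduct_grad]
      exact ((hf.differentiable (by norm_num)) _).hasFDerivAt.comp_hasDerivAt t hline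
    set φ : ℝ → ℝ := fun t => f (x + t • WithLp.toLp 2 u) + √(q t) with hφ
    set ψ : ℝ → ℝ := fun t =>
      grad n f (x + t • WithLp.toLp 2 u) ⬝ᵥ u + (-2 * a - 2 * t * b) / (2 * √(q t)) with hψ
    have hφmax : IsLocalMax φ 0 := by
      have hc : ContinuousAt (fun t : ℝ => x + t • WithLp.toLp 2 u) 0 := by fun_prop
      have hmax' : IsLocalMax (fun y => f y + √(r ^ 2 - ‖y‖ ^ 2))
          ((fun t : ℝ => x + t • WithLp.toLp 2 u) 0) := by simpa using hmax
      have : IsLocalMax ((fun y => f y + √(r ^ 2 - ‖y‖ ^ 2)) ∘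
          fun t : ℝ => x + t • WithLp.toLp 2 u) 0 := IsMaxFilter.comp_tendsto hmax' hc
      simpa only [Function.comp_def, hqn] using this
    have hφd : ∀ᶠ t in nhds 0, HasDerivAt φ (ψ t) t := by
      have hqc : ContinuousAt q 0 := (hqd 0).continuousAt
      filter_upwards [hqc.eventually_ne (y := 0) (by rw [hq0]; positivity)] with t ht
      exact (hfd t).add ((hqd t).sqrt ht)
    have hsq0 : √(q 0) = s := by rw [hq0, Real.sqrt_sq hs0.le]
    have hψd : HasDerivAt ψ
        (u ⬝ᵥ (hess n f x).mulVec u - (b / s + a ^ 2 / s ^ 3)) 0 := by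
      have hnum : HasDerivAt (fun t : ℝ => -2 * a - 2 * t * b) (-2 * b) 0 := by
        have := (((hasDerivAt_id (0 : ℝ)).const_mul 2).mul_const b).const_sub (-2 * a)
        refine this.congr_deriv ?_
        ring
      have hden := ((hqd 0).sqrt (by rw [hq0]; positivity)).const_mul 2
      have := (hasDerivAt_grad_dotProduct hf x u).add
        (hnum.div hden (by rw [hsq0]; positivity))
      refine this.congr_deriv ?_
      rw [hsq0]
      field_simp
      ring
    refine ⟨?_, nonpos_of_isLocalMax_of_hasDerivAt hφd hψd hφmax⟩
    have h0 : ψ 0 = 0 := hφmax.hasDerivAt_eq_zero hφd.self_of_nhds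
    simp only [hψ, hsq0, zero_smul, add_zero, mul_zero, zero_mul, sub_zero] at h0
    rw [eq_div_iff hs0.ne']
    field_simp at h0
    linarith
  have hg : ∀ i, grad n f x i = x i / s := by
    intro i
    simpa using (main (Pi.single i 1)).1
  have hw : √(1 + gradSq n f x) = r / s := by
    have h : 1 + gradSq n f x = (r / s) ^ 2 := by
      simp only [gradSq, hg, div_pow, ← Finset.sum_div]
      rw [← EuclideanSpace.real_norm_sq_eq]
      field_simp
      linarith
    rw [h, Real.sqrt_sq (by positivity)]
  intro u
  obtain ⟨h1, h2⟩ := main u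
  rw [hw, h1]
  have : r / s / r * (u ⬝ᵥ u + (x.ofLp ⬝ᵥ u / s) ^ 2) =
      (u ⬝ᵥ u) / s + (x.ofLp ⬝ᵥ u) ^ 2 / s ^ 3 := by field_simp
  linarith

/-- The symmetric square root of `(1+|g|²)^{-1/2} (I - g gᵀ/(1+|g|²))`. -/
noncomputable def metricRoot {n : ℕ} (g : Fin n → ℝ) : Matrix (Fin n) (Fin n) ℝ :=
  √(√(1 + g ⬝ᵥ g))⁻¹ •
    (1 - (√(1 + g ⬝ᵥ g) * (√(1 + g ⬝ᵥ g) + 1))⁻¹ • Matrix.vecMulVec g g)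

theorem metricRoot_isSymm {n : ℕ} (g : Fin n → ℝ) : (metricRoot g).IsSymm := by
  refine Matrix.IsSymm.ext fun i j => ?_
  simp [metricRoot, Matrix.vecMulVec_apply, Matrix.one_apply, eq_comm, mul_comm (g i)]

theorem sqrt_one_add_dotProduct_self {n : ℕ} (g : Fin n → ℝ) :
    0 < √(1 + g ⬝ᵥ g) ∧ g ⬝ᵥ g = √(1 + g ⬝ᵥ g) ^ 2 - 1 := by
  have h : 0 ≤ g ⬝ᵥ g := Finset.sum_nonneg fun i _ => mul_self_nonneg _
  exact ⟨by positivity, by rw [Real.sq_sqrt (by positivity)]; ring⟩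

theorem metricRoot_mul_self {n : ℕ} (g : Fin n → ℝ) :
    metricRoot g * metricRoot g =
      (√(1 + g ⬝ᵥ g))⁻¹ • (1 - (1 + g ⬝ᵥ g)⁻¹ • Matrix.vecMulVec g g) := by
  obtain ⟨hw, hg⟩ := sqrt_one_add_dotProduct_self g
  have hα : √(√(1 + g ⬝ᵥ g))⁻¹ * √(√(1 + g ⬝ᵥ g))⁻¹ = (√(1 + g ⬝ᵥ g))⁻¹ :=
    Real.mul_self_sqrt (by positivity)
  unfold metricRoot
  rw [smul_mul_smul_comm, hα]
  congr 1
  rw [show 1 + g ⬝ᵥ g = √(1 + g ⬝ᵥ g) ^ 2 by linarith, Real.sqrt_sq hw.le]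
  generalize √(1 + g ⬝ᵥ g) = w at *
  rw [sub_mul, mul_sub, mul_sub, one_mul, mul_one, one_mul, smul_mul_smul_comm,
    Matrix.vecMulVec_mul_vecMulVec, hg]
  ext i j
  simp only [Matrix.sub_apply, Matrix.smul_apply, smul_eq_mul, Matrix.vecMulVec_apply,
    Pi.smul_apply]
  field_simp
  ring

theorem metricRoot_mulVec {n : ℕ} (g u : Fin n → ℝ) :
    (metricRoot g).mulVec u = √(√(1 + g ⬝ᵥ g))⁻¹ •
      (u - ((√(1 + g ⬝ᵥ g) * (√(1 + g ⬝ᵥ g) + 1))⁻¹ * (g ⬝ᵥ u)) • g) := by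
  rw [metricRoot, Matrix.smul_mulVec, Matrix.sub_mulVec, Matrix.one_mulVec, Matrix.smul_mulVec,
    Matrix.vecMulVec_mulVec]
  simp [smul_smul]

/-- `metricRoot g` is an isometry up to the scale `√(1+|g|²)`, from the Euclidean metric to the
graph metric `|v|² + (g · v)²`. -/
theorem metricRoot_mulVec_norm {n : ℕ} (g u : Fin n → ℝ) :
    √(1 + g ⬝ᵥ g) * ((metricRoot g).mulVec u ⬝ᵥ (metricRoot g).mulVec u +
      (g ⬝ᵥ (metricRoot g).mulVec u) ^ 2) = u ⬝ᵥ u := by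
  obtain ⟨hw, hg⟩ := sqrt_one_add_dotProduct_self g
  have hα : √(√(1 + g ⬝ᵥ g))⁻¹ ^ 2 = (√(1 + g ⬝ᵥ g))⁻¹ := Real.sq_sqrt (by positivity)
  rw [metricRoot_mulVec]
  simp only [dotProduct_smul, smul_dotProduct, dotProduct_sub, sub_dotProduct, smul_eq_mul,
    dotProduct_comm u g]
  generalize √(√(1 + g ⬝ᵥ g))⁻¹ = a at *
  generalize √(1 + g ⬝ᵥ g) = w at *
  rw [hg]
  generalize g ⬝ᵥ u = p
  generalize u ⬝ᵥ u = q
  set y := p - (w * (w + 1))⁻¹ * p * (w ^ 2 - 1) with hy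
  calc _ = w * a ^ 2 * (q - (w * (w + 1))⁻¹ * p * p - (w * (w + 1))⁻¹ * p * y + y ^ 2) := by ring
    _ = q := by rw [hα, hy]; field_simp; ring

/-- The symmetric matrix similar to the shape operator. -/
noncomputable def symShapeOp (n : ℕ) (f : EuclideanSpace ℝ (Fin n) → ℝ)
    (x : EuclideanSpace ℝ (Fin n)) : Matrix (Fin n) (Fin n) ℝ :=
  metricRoot (grad n f x) * hess n f x * metricRoot (grad n f x)

theorem gradSq_eq_dotProduct {n : ℕ} (f : EuclideanSpace ℝ (Fin n) → ℝ)
    (x : EuclideanSpace ℝ (Fin n)) : gradSq n f x = grad n f x ⬝ᵥ grad n f x := by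
  simp [gradSq, dotProduct, pow_two]

theorem shapeOp_eq {n : ℕ} (f : EuclideanSpace ℝ (Fin n) → ℝ) (x : EuclideanSpace ℝ (Fin n)) :
    shapeOp n f x = metricRoot (grad n f x) * metricRoot (grad n f x) * hess n f x := by
  rw [metricRoot_mul_self, Matrix.smul_mul, shapeOp, gradSq_eq_dotProduct]
  congr 3
  ext i j
  simp [Matrix.vecMulVec_apply, div_eq_inv_mul]

theorem trace_shapeOp {n : ℕ} (f : EuclideanSpace ℝ (Fin n) → ℝ)
    (x : EuclideanSpace ℝ (Fin n)) : (shapeOp n f x).trace = (symShapeOp n f x).trace := by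
  rw [shapeOp_eq, symShapeOp, Matrix.mul_assoc, Matrix.trace_mul_comm]

theorem trace_shapeOp_mul_self {n : ℕ} (f : EuclideanSpace ℝ (Fin n) → ℝ)
    (x : EuclideanSpace ℝ (Fin n)) :
    (shapeOp n f x * shapeOp n f x).trace = (symShapeOp n f x * symShapeOp n f x).trace := by
  rw [shapeOp_eq, symShapeOp]
  simp only [Matrix.mul_assoc]
  rw [Matrix.trace_mul_comm]
  simp only [Matrix.mul_assoc]

theorem symShapeOp_isSymm {n : ℕ} {f : EuclideanSpace ℝ (Fin n) → ℝ} (hf : ContDiff ℝ 2 f)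
    (x : EuclideanSpace ℝ (Fin n)) : (symShapeOp n f x).IsSymm := by
  rw [Matrix.IsSymm, symShapeOp, Matrix.transpose_mul, Matrix.transpose_mul,
    (metricRoot_isSymm _).eq, (hess_isSymm hf x).eq, Matrix.mul_assoc]

theorem continuous_symShapeOp {n : ℕ} {f : EuclideanSpace ℝ (Fin n) → ℝ}
    (hf : ContDiff ℝ 2 f) : Continuous (symShapeOp n f) := by
  have hg := continuous_grad hf
  have hw : Continuous fun x => √(1 + grad n f x ⬝ᵥ grad n f x) :=
    (continuous_const.add (hg.dotProduct hg)).sqrt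
  have hw0 := fun x => (sqrt_one_add_dotProduct_self (grad n f x)).1
  have hS : Continuous fun x => metricRoot (grad n f x) := by
    refine (hw.inv₀ fun x => (hw0 x).ne').sqrt.smul (continuous_const.sub (Continuous.smul
      ((hw.mul (hw.add continuous_const)).inv₀ fun x => ?_) (hg.matrix_vecMulVec hg)))
    exact (mul_pos (hw0 x) (add_pos (hw0 x) one_pos)).ne'
  exact (hS.mul (continuous_hess hf)).mul hS

theorem eigenvalue_ricci_neg {n : ℕ} {f : EuclideanSpace ℝ (Fin n) → ℝ}
    {x : EuclideanSpace ℝ (Fin n)}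
    (hRic : ∀ (k : ℝ) (v : Fin n → ℝ), v ≠ 0 → (shapeOp n f x).mulVec v = k • v →
      k * ((shapeOp n f x).trace - k) < 0)
    {k : ℝ} {u : Fin n → ℝ} (hu : u ⬝ᵥ u = 1) (hk : (symShapeOp n f x).mulVec u = k • u) :
    k * ((symShapeOp n f x).trace - k) < 0 := by
  rw [← trace_shapeOp]
  refine hRic k ((metricRoot (grad n f x)).mulVec u) (fun h0 => ?_) ?_
  · have := metricRoot_mulVec_norm (grad n f x) u
    rw [h0, hu] at this
    simp at this
  · rw [← Matrix.mulVec_smul, ← hk, shapeOp_eq, symShapeOp]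
    simp only [Matrix.mulVec_mulVec, Matrix.mul_assoc]

theorem exists_symShapeOp_le {n : ℕ} {f : EuclideanSpace ℝ (Fin n) → ℝ}
    (hf : ContDiff ℝ 2 f) {r : ℝ} (hr : 0 < r) :
    ∃ x, ∀ u, u ⬝ᵥ (symShapeOp n f x).mulVec u ≤ 1 / r * (u ⬝ᵥ u) := by
  obtain ⟨x, hx⟩ := exists_hess_le_of_hemisphere hf hr
  refine ⟨x, fun u => ?_⟩
  have h := hx ((metricRoot (grad n f x)).mulVec u)
  have h2 : u ⬝ᵥ (symShapeOp n f x).mulVec u = (metricRoot (grad n f x)).mulVec u ⬝ᵥ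
      (hess n f x).mulVec ((metricRoot (grad n f x)).mulVec u) := by
    rw [symShapeOp, ← Matrix.mulVec_mulVec, ← Matrix.mulVec_mulVec, Matrix.dotProduct_mulVec,
      ← Matrix.mulVec_transpose, (metricRoot_isSymm _).eq]
  rw [h2, ← metricRoot_mulVec_norm (grad n f x) u, ← gradSq_eq_dotProduct]
  convert h using 1
  ring

theorem symShapeOp_neg {n : ℕ} (f : EuclideanSpace ℝ (Fin n) → ℝ)
    (x : EuclideanSpace ℝ (Fin n)) : symShapeOp n (-f) x = -symShapeOp n f x := by
  have hneg : ∀ y, fderiv ℝ (-f) y = -fderiv ℝ f y := fun y => fderiv_neg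
  have hg : grad n (-f) x = -grad n f x := by
    ext i; simp [grad, hneg]
  have hh : hess n (-f) x = -hess n f x := by
    ext i j; simp [hess, hneg, fderiv_fun_neg]
  have hS : ∀ g : Fin n → ℝ, metricRoot (-g) = metricRoot g := by
    intro g; simp [metricRoot]
  simp [symShapeOp, hg, hh, hS]

/-- The symmetric matrix `B` has at least two negative eigenvalues. -/
def HasTwoNegEigenvalues {n : ℕ} (B : Matrix (Fin n) (Fin n) ℝ) : Prop :=
  ∃ l e, IsDiagonalization B l e ∧ ∃ i j, i ≠ j ∧ l i < 0 ∧ l j < 0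

theorem two_neg_or_pos_off_point {n : ℕ} (hn : 0 < n) {l : Fin n → ℝ} (hl : ∀ i, l i ≠ 0) :
    (∃ i j, i ≠ j ∧ l i < 0 ∧ l j < 0) ∨ ∃ k, ∀ a, a ≠ k → 0 < l a := by
  by_cases hk : ∃ k, l k < 0
  · obtain ⟨k, hk⟩ := hk
    by_contra! h
    obtain ⟨a, ha, hle⟩ := h.2 k
    exact (h.1 a k ha (lt_of_le_of_ne hle (hl a))).not_gt hk
  · push Not at hk
    exact .inr ⟨⟨0, hn⟩, fun a _ => lt_of_le_of_ne (hk a) (hl a).symm⟩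

theorem IsDiagonalization.ne_zero {n : ℕ} {B : Matrix (Fin n) (Fin n) ℝ} {l : Fin n → ℝ}
    {e : Fin n → Fin n → ℝ} (h : IsDiagonalization B l e)
    (h0 : ∀ u : Fin n → ℝ, u ⬝ᵥ u = 1 → B.mulVec u ≠ 0) (i : Fin n) : l i ≠ 0 :=
  fun hi => h0 (e i) (by simp [h.orthonormal]) (by rw [h.mulVec_eq, hi, zero_smul])

/-- Whether a nonsingular symmetric matrix has at least two negative eigenvalues is unchanged by
small perturbations. -/
theorem exists_hasTwoNegEigenvalues_iff {n : ℕ} {B : Matrix (Fin n) (Fin n) ℝ} (hB : B.IsSymm)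
    (hn : 0 < n) (h0 : ∀ u : Fin n → ℝ, u ⬝ᵥ u = 1 → B.mulVec u ≠ 0) :
    ∃ η > 0, ∀ C : Matrix (Fin n) (Fin n) ℝ, C.IsSymm →
      (∀ u : Fin n → ℝ, u ⬝ᵥ u = 1 → C.mulVec u ≠ 0) →
      ∑ i, ∑ j, |(C - B) i j| < η → (HasTwoNegEigenvalues C ↔ HasTwoNegEigenvalues B) := by
  have hpos : ∀ v : Fin n → ℝ, v ≠ 0 → 0 < v ⬝ᵥ v := fun v hv => by
    simpa using Matrix.dotProduct_star_self_pos_iff.mpr hv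
  obtain ⟨l, e, hBl⟩ := hB.exists_diagonalization
  have hl0 := hBl.ne_zero h0
  have : Nonempty (Fin n) := ⟨⟨0, hn⟩⟩
  obtain ⟨i₀, hi₀⟩ := Finite.exists_min fun i => |l i|
  have hi₀0 : 0 < |l i₀| := abs_pos.mpr (hl0 i₀)
  refine ⟨|l i₀|, hi₀0, fun C hC hC0 hclose => ?_⟩
  obtain ⟨m, g, hCm⟩ := hC.exists_diagonalization
  have hdiff : ∀ v : Fin n → ℝ, v ≠ 0 →
      |v ⬝ᵥ C.mulVec v - v ⬝ᵥ B.mulVec v| < |l i₀| * (v ⬝ᵥ v) := by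
    intro v hv
    rw [← dotProduct_sub, ← Matrix.sub_mulVec]
    exact (abs_dotProduct_mulVec_le _ v).trans_lt (mul_lt_mul_of_pos_right hclose (hpos v hv))
  have hge : ∀ a, 0 < l a → |l i₀| ≤ l a := fun a ha => (hi₀ a).trans_eq (abs_of_pos ha)
  have hle : ∀ a, l a < 0 → l a ≤ -|l i₀| := fun a ha => by
    have := hi₀ a
    rw [abs_of_neg ha] at this
    linarith
  rcases two_neg_or_pos_off_point hn hl0 with ⟨i, j, hij, hi, hj⟩ | ⟨k, hk⟩
  · refine iff_of_true ?_ ⟨l, e, hBl, i, j, hij, hi, hj⟩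
    rcases two_neg_or_pos_off_point hn (hCm.ne_zero hC0) with h | ⟨k, hk⟩
    · exact ⟨m, g, hCm, h⟩
    · refine (not_close_of_two_neg hBl hCm hij (hle i hi) (hle j hj) (ν := 0)
        (fun a ha => (hk a ha).le) fun v hv => ?_).elim
      linarith [(abs_lt.mp (hdiff v hv)).2]
  · refine iff_of_false ?_ ?_
    · rintro ⟨l', e', hl', i, j, hij, hi, hj⟩
      refine not_close_of_two_neg (μ := 0) hl' hBl hij (by linarith) (by linarith)
        (fun a ha => hge a (hk a ha)) fun v hv => ?_
      linarith [(abs_lt.mp (hdiff v hv)).1]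
    · rintro ⟨l', e', hl', i, j, hij, hi, hj⟩
      refine not_close_of_two_neg (μ := 0) hl' hBl hij (by linarith) (by linarith)
        (fun a ha => hge a (hk a ha)) fun v hv => ?_
      rw [sub_self, zero_add]
      exact mul_pos hi₀0 (hpos v hv)

/-- For a continuous family of nonsingular symmetric matrices over a connected space, having at
least two negative eigenvalues holds everywhere or nowhere. -/
theorem forall_or_forall_not_hasTwoNegEigenvalues {X : Type*} [TopologicalSpace X]
    [PreconnectedSpace X] {n : ℕ} (hn : 0 < n) {B : X → Matrix (Fin n) (Fin n) ℝ}
    (hcont : Continuous B) (hB : ∀ x, (B x).IsSymm)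
    (h0 : ∀ x, ∀ u : Fin n → ℝ, u ⬝ᵥ u = 1 → (B x).mulVec u ≠ 0) :
    (∀ x, HasTwoNegEigenvalues (B x)) ∨ ∀ x, ¬ HasTwoNegEigenvalues (B x) := by
  have hloc : ∀ x, ∀ᶠ y in nhds x,
      (HasTwoNegEigenvalues (B y) ↔ HasTwoNegEigenvalues (B x)) := by
    intro x
    obtain ⟨η, hη, h⟩ := exists_hasTwoNegEigenvalues_iff (hB x) hn (h0 x)
    have hc : Continuous fun y => ∑ i, ∑ j, |(B y - B x) i j| := by
      have : Continuous fun y => B y - B x := hcont.sub continuous_const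
      exact continuous_finsetSum _ fun i _ => continuous_finsetSum _ fun j _ =>
        (this.matrix_elem i j).abs
    filter_upwards [hc.continuousAt.eventually_lt continuousAt_const (by simpa using hη)] with y hy
      using h (B y) (hB y) (h0 y) hy
  have hclopen : IsClopen {x | HasTwoNegEigenvalues (B x)} := by
    refine ⟨⟨isOpen_iff_mem_nhds.mpr fun x hx => ?_⟩, isOpen_iff_mem_nhds.mpr fun x hx => ?_⟩
    · filter_upwards [hloc x] with y hy using fun h => hx (hy.mp h)
    · filter_upwards [hloc x] with y hy using hy.mpr hx
  rcases isClopen_iff.mp hclopen with h | h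
  · exact .inr fun x hx => by simpa [h] using (show x ∈ {x | HasTwoNegEigenvalues (B x)} from hx)
  · exact .inl fun x => (h ▸ Set.mem_univ x : x ∈ {x | HasTwoNegEigenvalues (B x)})

theorem IsDiagonalization.le_of_quadratic_le {n : ℕ} {B : Matrix (Fin n) (Fin n) ℝ}
    {l : Fin n → ℝ} {e : Fin n → Fin n → ℝ} (h : IsDiagonalization B l e) {d : ℝ}
    (hd : ∀ u, u ⬝ᵥ B.mulVec u ≤ d * (u ⬝ᵥ u)) (i : Fin n) : l i ≤ d := by
  simpa [h.mulVec_eq, h.orthonormal] using hd (e i)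

/-- **Corollary 2 (improving Chern; Smith–Xavier question for entire graphs).**
If an entire graph in `ℝ^{n+1}`, `n ≥ 3`, has negative Ricci curvature, then
`inf |A| = 0`: for every `ε > 0` there is a point where `|A| < ε`. -/
theorem inf_normA_entire_graph_eq_zero_of_negative_ricci
    (n : ℕ) (hn : 3 ≤ n)
    (f : EuclideanSpace ℝ (Fin n) → ℝ) (hf : ContDiff ℝ 2 f)
    (hRic : ∀ x : EuclideanSpace ℝ (Fin n),
      ∀ (k : ℝ) (v : Fin n → ℝ), v ≠ 0 → (shapeOp n f x).mulVec v = k • v →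
        k * ((shapeOp n f x).trace - k) < 0) :
    ∀ ε > 0, ∃ x : EuclideanSpace ℝ (Fin n), normA n f x < ε := by
  intro ε hε
  obtain ⟨r, hr, hrε⟩ : ∃ r > 0, (n : ℝ) * (n * (1 / r)) ^ 2 < ε ^ 2 := by
    have hn0 : (0 : ℝ) < n := by exact_mod_cast (by omega : 0 < n)
    refine ⟨2 * n ^ 2 / ε, by positivity, ?_⟩
    have hn1 : (1 : ℝ) ≤ n := by exact_mod_cast (by omega : 1 ≤ n)
    have : (n : ℝ) * (n * (1 / (2 * n ^ 2 / ε))) ^ 2 = ε ^ 2 / (4 * n) := by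
      field_simp
      norm_num
    rw [this, div_lt_iff₀ (by positivity)]
    nlinarith [sq_pos_of_pos hε]
  have hsymm := symShapeOp_isSymm hf
  have hpinch : ∀ x l e, IsDiagonalization (symShapeOp n f x) l e →
      ∀ i, l i * (∑ k, l k - l i) < 0 := fun x l e h i => by
    rw [← h.trace_eq]
    exact eigenvalue_ricci_neg (hRic x) (by simp [h.orthonormal]) (h.mulVec_eq i)
  have hne : ∀ x, ∀ u : Fin n → ℝ, u ⬝ᵥ u = 1 → (symShapeOp n f x).mulVec u ≠ 0 := by
    intro x u hu h0
    simpa using eigenvalue_ricci_neg (hRic x) hu (k := 0) (by rw [h0, zero_smul])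
  have hfin : ∀ x l e, IsDiagonalization (symShapeOp n f x) l e →
      ∑ k, l k ^ 2 ≤ n * (n * (1 / r)) ^ 2 → normA n f x < ε := by
    intro x l e h hle
    rw [normA, trace_shapeOp_mul_self, h.trace_mul_self, Real.sqrt_lt' hε]
    exact hle.trans_lt hrε
  rcases forall_or_forall_not_hasTwoNegEigenvalues (by omega) (continuous_symShapeOp hf) hsymm hne
    with hall | hnone
  · obtain ⟨x, hx⟩ := exists_symShapeOp_le hf hr
    obtain ⟨l, e, h, i, j, hij, hi, hj⟩ := hall x
    exact ⟨x, hfin x l e h (sum_sq_le_of_sub_pos hij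
      (pos_of_mul_neg_right (hpinch x l e h i) hi.le)
      (pos_of_mul_neg_right (hpinch x l e h j) hj.le) (by positivity)
      (h.le_of_quadratic_le hx))⟩
  · obtain ⟨x, hx⟩ := exists_symShapeOp_le hf.neg hr
    obtain ⟨l, e, h⟩ := (hsymm x).exists_diagonalization
    obtain ⟨k, hk⟩ := (two_neg_or_pos_off_point (by omega) (h.ne_zero (hne x))).resolve_left
      fun h' => hnone x ⟨l, e, h, h'⟩
    obtain ⟨i, hi, j, hj, hij⟩ : ∃ i ∈ univ.erase k, ∃ j ∈ univ.erase k, i ≠ j := by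
      refine Finset.one_lt_card.mp ?_
      rw [Finset.card_erase_of_mem (Finset.mem_univ k), Finset.card_univ, Fintype.card_fin]
      omega
    have hsub : ∀ a ∈ univ.erase k, 0 < ∑ b, -l b - -l a := fun a ha => by
      rw [Finset.sum_neg_distrib]
      have := neg_of_mul_neg_right (hpinch x l e h a) (hk a (Finset.ne_of_mem_erase ha)).le
      linarith
    refine ⟨x, hfin x l e h ?_⟩
    simpa using sum_sq_le_of_sub_pos hij (hsub i hi) (hsub j hj) (by positivity) fun a => by
      have := hx (e a)
      rw [show (fun y => -f y) = -f from rfl, symShapeOp_neg] at this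
      simpa [Matrix.neg_mulVec, h.mulVec_eq, h.orthonormal] using this
end

section
/- Let n ≥ 2 and let f : ℝⁿ → ℝ be a C² function such that |A|(x) = √(tr(W(x)²)) is constant on ℝⁿ and the mean curvature does not change sign (either H(x) ≥ 0 for all x or H(x) ≤ 0 for all x). Then the graph of f is a hyperplane; equivalently, W(x) = 0 for all x, i.e. D²f(x) = 0 for all x, so f is an affine function. -/
open Metric Finset

section Integration

open MeasureTheory Topology

theorem hasDerivAt_integral_of_continuous_of_compact {E : Type*} [NormedAddCommGroup E] [MeasurableSpace E]
    [BorelSpace E] (μ : Measure E) [IsFiniteMeasureOnCompacts μ] {k k' : ℝ → E → ℝ} {K : Set E}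
    (hK : IsCompact K) (hk : Continuous fun p : ℝ × E => k p.1 p.2)
    (hk' : Continuous fun p : ℝ × E => k' p.1 p.2)
    (hd : ∀ t x, HasDerivAt (k · x) (k' t x) t)
    (h0 : ∀ t ∈ Set.Icc (-1 : ℝ) 1, ∀ x ∉ K, k t x = 0 ∧ k' t x = 0) :
    HasDerivAt (fun t => ∫ x, k t x ∂μ) (∫ x, k' 0 x ∂μ) 0 := by
  obtain ⟨M, hM⟩ := ((isCompact_Icc (a := (-1 : ℝ)) (b := 1)).prod hK).exists_bound_of_continuousOn
    hk'.continuousOn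
  have hs : Set.Icc (-1 : ℝ) 1 ∈ 𝓝 (0 : ℝ) := Icc_mem_nhds (by norm_num) (by norm_num)
  have hck (t : ℝ) : Continuous (k t) := hk.comp (Continuous.prodMk_right t)
  refine (hasDerivAt_integral_of_dominated_loc_of_deriv_le (bound := K.indicator fun _ => M)
    hs (.of_forall fun t => (hck t).aestronglyMeasurable) ?_
    (hk'.comp (Continuous.prodMk_right 0)).aestronglyMeasurable (.of_forall fun x t ht => ?_)
    ?_ (.of_forall fun x t _ => hd t x)).2
  · exact (hck 0).integrable_of_hasCompactSupport
      (.intro hK fun x hx => (h0 0 (by norm_num) x hx).1)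
  · by_cases hx : x ∈ K
    · simpa [hx] using hM (t, x) ⟨ht, hx⟩
    · simp [hx, (h0 t ht x hx).2]
  · exact (integrable_indicator_iff hK.measurableSet).2 (integrableOn_const hK.measure_ne_top)

variable {E : Type*} [NormedAddCommGroup E] [NormedSpace ℝ E]

theorem continuous_fderiv_apply_const {u : E → ℝ} (hu : ContDiff ℝ 1 u) (v : E) :
    Continuous fun x => fderiv ℝ u x v :=
  (hu.continuous_fderiv one_ne_zero).clm_apply continuous_const

theorem hasDerivAt_comp_add_smul {b : E → ℝ} (hb : ContDiff ℝ 1 b) (x w : E) (t : ℝ) :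
    HasDerivAt (fun s : ℝ => b (x + s • w)) (fderiv ℝ b (x + t • w) w) t := by
  have h1 : HasDerivAt (fun s : ℝ => x + s • w) w t := by
    simpa using ((hasDerivAt_id t).smul_const w).const_add x
  exact (hb.differentiable one_ne_zero _).hasFDerivAt.comp_hasDerivAt t h1

theorem contDiff_fderiv_apply_const {φ : E → ℝ} (hφ : ContDiff ℝ 2 φ) (v : E) :
    ContDiff ℝ 1 fun x => fderiv ℝ φ x v :=
  (hφ.fderiv_right (m := 1) (by norm_num)).clm_apply contDiff_const

theorem fderiv_mul_apply {a b : E → ℝ} (ha : ContDiff ℝ 1 a) (hb : ContDiff ℝ 1 b) (x v : E) :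
    fderiv ℝ (fun y => a y * b y) x v = fderiv ℝ a x v * b x + a x * fderiv ℝ b x v := by
  rw [fderiv_fun_mul (ha.differentiable one_ne_zero x) (hb.differentiable one_ne_zero x)]
  simp
  ring

variable [FiniteDimensional ℝ E] [MeasurableSpace E] [BorelSpace E]
  (μ : Measure E) [μ.IsAddHaarMeasure]

theorem integral_mul_fderiv_eq_neg_of_hasCompactSupport {u b : E → ℝ} (hu : ContDiff ℝ 1 u)
    (hb : ContDiff ℝ 1 b) (hc : HasCompactSupport u) (v : E) :
    ∫ x, u x * fderiv ℝ b x v ∂μ = -∫ x, fderiv ℝ u x v * b x ∂μ := by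
  refine integral_mul_fderiv_eq_neg_fderiv_mul_of_integrable ?_ ?_ ?_
    (fun x _ => hu.differentiable one_ne_zero x) (fun x _ => hb.differentiable one_ne_zero x)
  · exact ((continuous_fderiv_apply_const hu v).mul hb.continuous).integrable_of_hasCompactSupport
      (hc.fderiv_apply (𝕜 := ℝ) v).mul_right
  · exact (hu.continuous.mul (continuous_fderiv_apply_const hb v)).integrable_of_hasCompactSupport
      hc.mul_right
  · exact (hu.continuous.mul hb.continuous).integrable_of_hasCompactSupport hc.mul_right

/-- Symmetry of second derivatives in the weak form `∫ ∂ᵥu ∂_w b = ∫ ∂_w u ∂ᵥb`. -/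
theorem integral_fderiv_mul_fderiv_comm {u b : E → ℝ} (hu : ContDiff ℝ 1 u)
    (hb : ContDiff ℝ 1 b) (hc : HasCompactSupport u) (v w : E) :
    ∫ x, fderiv ℝ u x v * fderiv ℝ b x w ∂μ = ∫ x, fderiv ℝ u x w * fderiv ℝ b x v ∂μ := by
  obtain ⟨R, hR⟩ := hc.isCompact.isBounded.subset_closedBall (0 : E)
  have hu0 {x : E} (hx : x ∉ closedBall (0 : E) R) : u x = 0 ∧ fderiv ℝ u x = 0 := by
    have hx' : x ∉ tsupport u := fun h => hx (hR h)
    exact ⟨image_eq_zero_of_notMem_tsupport hx',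
      by_contra fun h => hx' (support_fderiv_subset ℝ h)⟩
  have hKc : IsCompact (closedBall (0 : E) (R + ‖w‖)) := isCompact_closedBall _ _
  have hout {x : E} (hx : x ∉ closedBall (0 : E) (R + ‖w‖)) {t : ℝ} (ht : t ∈ Set.Icc (-1 : ℝ) 1) :
      x + t • (-w) ∉ closedBall (0 : E) R := by
    simp only [mem_closedBall, dist_zero_right, not_le] at hx ⊢
    have h1 : ‖t • (-w)‖ ≤ ‖w‖ := by
      rw [norm_smul, norm_neg]
      exact mul_le_of_le_one_left (norm_nonneg _) (abs_le.2 ht)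
    have h2 : ‖x‖ ≤ ‖x + t • (-w)‖ + ‖t • (-w)‖ := by
      simpa using norm_sub_le (x + t • (-w)) (t • (-w))
    linarith
  have cu := continuous_fderiv_apply_const hu
  have cb := continuous_fderiv_apply_const hb
  have hL : HasDerivAt (fun t : ℝ => ∫ x, fderiv ℝ u x v * b (x + t • w) ∂μ)
      (∫ x, fderiv ℝ u x v * fderiv ℝ b (x + (0 : ℝ) • w) w ∂μ) 0 := by
    refine hasDerivAt_integral_of_continuous_of_compact μ
      (k' := fun t x => fderiv ℝ u x v * fderiv ℝ b (x + t • w) w) hKc ?_ ?_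
      (fun t x => (hasDerivAt_comp_add_smul hb x w t).const_mul _) ?_
    · exact ((cu v).comp continuous_snd).mul (hb.continuous.comp (by fun_prop))
    · exact ((cu v).comp continuous_snd).mul ((cb w).comp (by fun_prop))
    · intro t _ x hx
      have : x ∉ closedBall (0 : E) R :=
        fun h => hx (closedBall_subset_closedBall (by linarith [norm_nonneg w]) h)
      simp [(hu0 this).2]
  have hRt : HasDerivAt (fun t : ℝ => ∫ x, fderiv ℝ b x v * u (x + t • (-w)) ∂μ)
      (∫ x, fderiv ℝ b x v * fderiv ℝ u (x + (0 : ℝ) • (-w)) (-w) ∂μ) 0 := by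
    refine hasDerivAt_integral_of_continuous_of_compact μ
      (k' := fun t x => fderiv ℝ b x v * fderiv ℝ u (x + t • (-w)) (-w)) hKc ?_ ?_
      (fun t x => (hasDerivAt_comp_add_smul hu x (-w) t).const_mul _) ?_
    · exact ((cb v).comp continuous_snd).mul (hu.continuous.comp (by fun_prop))
    · exact ((cb v).comp continuous_snd).mul ((cu (-w)).comp (by fun_prop))
    · intro t ht x hx
      have h := hu0 (hout hx ht)
      rw [h.1, h.2]
      simp
  have heq : (fun t : ℝ => ∫ x, fderiv ℝ u x v * b (x + t • w) ∂μ) =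
      fun t : ℝ => -∫ x, fderiv ℝ b x v * u (x + t • (-w)) ∂μ := by
    ext t
    have h1 := integral_mul_fderiv_eq_neg_of_hasCompactSupport μ hu
      (b := fun x => b (x + t • w)) (hb.comp (contDiff_id.add contDiff_const)) hc v
    simp only [fderiv_comp_add_right] at h1
    have h2 := integral_add_right_eq_self (μ := μ)
      (fun x => fderiv ℝ b x v * u (x + t • (-w))) (t • w)
    rw [← h2, ← neg_eq_iff_eq_neg, ← h1]
    congr 1 with x
    rw [smul_neg, add_neg_cancel_right, mul_comm]
  rw [heq] at hL
  have := hL.unique hRt.neg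
  simp only [zero_smul, add_zero, map_neg, mul_neg, integral_neg, neg_neg] at this
  rw [this]
  congr 1 with x
  ring

/-- A two-dimensional Jacobian is the sum of terms in which a derivative falls on the
test function. -/
theorem integral_mul_jacobian {φ a b : E → ℝ} (hφ : ContDiff ℝ 2 φ) (hc : HasCompactSupport φ)
    (ha : ContDiff ℝ 1 a) (hb : ContDiff ℝ 1 b) (v w : E) :
    ∫ x, φ x * (fderiv ℝ a x w * fderiv ℝ b x v - fderiv ℝ a x v * fderiv ℝ b x w) ∂μ =
      ∫ x, (fderiv ℝ φ x v * a x * fderiv ℝ b x w + fderiv ℝ φ x w * fderiv ℝ a x v * b x +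
        fderiv ℝ (fun y => fderiv ℝ φ y w) x v * a x * b x) ∂μ := by
  have hφ1 : ContDiff ℝ 1 φ := hφ.of_le (by norm_num)
  have hφw := contDiff_fderiv_apply_const hφ w
  have hcw : HasCompactSupport fun x => fderiv ℝ φ x w := hc.fderiv_apply (𝕜 := ℝ) w
  have cφ := continuous_fderiv_apply_const hφ1
  have ca := continuous_fderiv_apply_const ha
  have cb := continuous_fderiv_apply_const hb
  have cφφ := continuous_fderiv_apply_const hφw v
  have hcv : HasCompactSupport fun x => fderiv ℝ φ x v := hc.fderiv_apply (𝕜 := ℝ) v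
  have hcwv : HasCompactSupport fun x => fderiv ℝ (fun y => fderiv ℝ φ y w) x v :=
    hcw.fderiv_apply (𝕜 := ℝ) v
  have h1 := integral_fderiv_mul_fderiv_comm μ (hφ1.mul ha) hb hc.mul_right w v
  have h2 := integral_mul_fderiv_eq_neg_of_hasCompactSupport μ (hφw.mul ha) hb hcw.mul_right v
  simp only [fderiv_mul_apply hφ1 ha, fderiv_mul_apply hφw ha] at h1 h2
  have ac := ha.continuous
  have bc := hb.continuous
  have pc := hφ.continuous
  have i1 : Integrable (fun x => φ x * (fderiv ℝ a x w * fderiv ℝ b x v)) μ :=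
    (pc.mul ((ca w).mul (cb v))).integrable_of_hasCompactSupport hc.mul_right
  have i2 : Integrable (fun x => φ x * (fderiv ℝ a x v * fderiv ℝ b x w)) μ :=
    (pc.mul ((ca v).mul (cb w))).integrable_of_hasCompactSupport hc.mul_right
  have i3 : Integrable (fun x => fderiv ℝ φ x w * a x * fderiv ℝ b x v) μ :=
    (((cφ w).mul ac).mul (cb v)).integrable_of_hasCompactSupport hcw.mul_right.mul_right
  have i4 : Integrable (fun x => fderiv ℝ φ x v * a x * fderiv ℝ b x w) μ :=
    (((cφ v).mul ac).mul (cb w)).integrable_of_hasCompactSupport hcv.mul_right.mul_right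
  have i5 : Integrable (fun x => fderiv ℝ φ x w * fderiv ℝ a x v * b x) μ :=
    (((cφ w).mul (ca v)).mul bc).integrable_of_hasCompactSupport hcw.mul_right.mul_right
  have i6 : Integrable (fun x => fderiv ℝ (fun y => fderiv ℝ φ y w) x v * a x * b x) μ :=
    ((cφφ.mul ac).mul bc).integrable_of_hasCompactSupport hcwv.mul_right.mul_right
  simp only [add_mul, mul_assoc, mul_sub] at h1 h2 i1 i2 i3 i4 i5 i6 ⊢
  rw [integral_add i3 i1, integral_add i4 i2] at h1
  rw [integral_add i6 i5] at h2
  rw [integral_sub i1 i2, integral_add (i4.fun_add i5) i6, integral_add i4 i5]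
  linarith

theorem mul_integral_le_of_trace_sq_const {ι : Type*} [Fintype ι] {φ : E → ℝ}
    (hφ : ContDiff ℝ 2 φ) (hc : HasCompactSupport φ) (hφ0 : ∀ x, 0 ≤ φ x) (e : ι → E)
    {G : ι → E → ℝ} (hG : ∀ i, ContDiff ℝ 1 (G i)) (hG1 : ∀ i x, |G i x| ≤ 1) {A D : ℝ}
    (hA : ∀ x, ∑ i, ∑ j, fderiv ℝ (G i) x (e j) * fderiv ℝ (G j) x (e i) = A)
    (hd0 : ∀ x, 0 ≤ ∑ i, fderiv ℝ (G i) x (e i))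
    (hdD : ∀ x, ∑ i, fderiv ℝ (G i) x (e i) ≤ D) :
    A * ∫ x, φ x ∂μ ≤ D * (3 * ∫ x, ∑ i, |fderiv ℝ φ x (e i)| ∂μ) +
      ∫ x, ∑ i, ∑ j, |fderiv ℝ (fun y => fderiv ℝ φ y (e j)) x (e i)| ∂μ := by
  have hφ1 : ContDiff ℝ 1 φ := hφ.of_le (by norm_num)
  have cφ := continuous_fderiv_apply_const hφ1
  have pc := hφ.continuous
  have cG (i : ι) := (hG i).continuous
  have cdG (i : ι) := continuous_fderiv_apply_const (hG i)
  have cφφ (i j : ι) := continuous_fderiv_apply_const (contDiff_fderiv_apply_const hφ (e j)) (e i)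
  have hc1 (v : E) : HasCompactSupport fun x => fderiv ℝ φ x v := hc.fderiv_apply (𝕜 := ℝ) v
  have hc2 (v w : E) : HasCompactSupport fun x => fderiv ℝ (fun y => fderiv ℝ φ y w) x v :=
    (hc1 w).fderiv_apply (𝕜 := ℝ) v
  have hD0 : 0 ≤ D := (hd0 0).trans (hdD 0)
  have i1 (i : ι) : Integrable (fun x => |fderiv ℝ φ x (e i)|) μ :=
    ((cφ (e i)).integrable_of_hasCompactSupport (hc1 _)).abs
  have i2 (i j : ι) : Integrable
      (fun x => |fderiv ℝ (fun y => fderiv ℝ φ y (e j)) x (e i)|) μ :=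
    ((cφφ i j).integrable_of_hasCompactSupport (hc2 _ _)).abs
  have i1s := integrable_finsetSum univ fun i _ => i1 i
  have i2s := integrable_finsetSum univ fun i _ => integrable_finsetSum univ fun j _ => i2 i j
  have cd : Continuous fun x => ∑ i, fderiv ℝ (G i) x (e i) :=
    continuous_finsetSum _ fun i _ => cdG i (e i)
  have hdiv : ∫ x, φ x * ∑ i, fderiv ℝ (G i) x (e i) ∂μ ≤
      ∫ x, ∑ i, |fderiv ℝ φ x (e i)| ∂μ := by
    have i3 (i : ι) : Integrable (fun x => φ x * fderiv ℝ (G i) x (e i)) μ :=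
      (pc.mul (cdG i (e i))).integrable_of_hasCompactSupport hc.mul_right
    simp only [mul_sum]
    rw [integral_finsetSum _ fun i _ => i3 i, integral_finsetSum _ fun i _ => i1 i]
    refine sum_le_sum fun i _ => ?_
    rw [integral_mul_fderiv_eq_neg_of_hasCompactSupport μ hφ1 (hG i) hc, ← integral_neg]
    refine integral_mono ((((cφ (e i)).mul (cG i)).integrable_of_hasCompactSupport
      (hc1 _).mul_right).neg) (i1 i) fun x => ?_
    refine (neg_le_abs _).trans ?_
    rw [abs_mul]
    exact mul_le_of_le_one_right (abs_nonneg _) (hG1 i x)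
  have i4 : Integrable (fun x => φ x * (∑ i, fderiv ℝ (G i) x (e i)) ^ 2) μ :=
    (pc.mul (cd.pow 2)).integrable_of_hasCompactSupport hc.mul_right
  have hsq : ∫ x, φ x * (∑ i, fderiv ℝ (G i) x (e i)) ^ 2 ∂μ ≤
      D * ∫ x, ∑ i, |fderiv ℝ φ x (e i)| ∂μ := by
    refine le_trans ?_ (mul_le_mul_of_nonneg_left hdiv hD0)
    rw [← integral_const_mul]
    refine integral_mono i4
      (((pc.mul cd).integrable_of_hasCompactSupport hc.mul_right).const_mul D) fun x => ?_
    have := mul_le_mul_of_nonneg_left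
      (mul_le_mul_of_nonneg_right (hdD x) (hd0 x)) (hφ0 x)
    dsimp only
    linarith
  let J (i j : ι) (x : E) : ℝ := φ x * (fderiv ℝ (G i) x (e j) * fderiv ℝ (G j) x (e i) -
    fderiv ℝ (G i) x (e i) * fderiv ℝ (G j) x (e j))
  let L (i j : ι) (x : E) : ℝ := fderiv ℝ φ x (e i) * G i x * fderiv ℝ (G j) x (e j) +
    fderiv ℝ φ x (e j) * fderiv ℝ (G i) x (e i) * G j x +
    fderiv ℝ (fun y => fderiv ℝ φ y (e j)) x (e i) * G i x * G j x
  have iJ (i j : ι) : Integrable (J i j) μ :=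
    (pc.mul (((cdG i (e j)).mul (cdG j (e i))).sub
      ((cdG i (e i)).mul (cdG j (e j))))).integrable_of_hasCompactSupport hc.mul_right
  have iL (i j : ι) : Integrable (L i j) μ := by
    refine (Integrable.add ?_ ?_).add ?_
    · exact (((cφ (e i)).mul (cG i)).mul (cdG j (e j))).integrable_of_hasCompactSupport
        (hc1 _).mul_right.mul_right
    · exact (((cφ (e j)).mul (cdG i (e i))).mul (cG j)).integrable_of_hasCompactSupport
        (hc1 _).mul_right.mul_right
    · exact (((cφφ i j).mul (cG i)).mul (cG j)).integrable_of_hasCompactSupport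
        (hc2 _ _).mul_right.mul_right
  have hJL : ∫ x, ∑ i, ∑ j, J i j x ∂μ = ∫ x, ∑ i, ∑ j, L i j x ∂μ := by
    rw [integral_finsetSum _ fun i _ => integrable_finsetSum _ fun j _ => iJ i j,
      integral_finsetSum _ fun i _ => integrable_finsetSum _ fun j _ => iL i j]
    refine sum_congr rfl fun i _ => ?_
    rw [integral_finsetSum _ fun j _ => iJ i j, integral_finsetSum _ fun j _ => iL i j]
    exact sum_congr rfl fun j _ => integral_mul_jacobian μ hφ hc (hG i) (hG j) (e i) (e j)
  have hJ (x : E) : φ x * A = ∑ i, ∑ j, J i j x + φ x * (∑ i, fderiv ℝ (G i) x (e i)) ^ 2 := by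
    simp only [J, ← mul_sum, sum_sub_distrib, hA x]
    rw [pow_two, ← sum_mul]
    ring
  have hL (x : E) : ∑ i, ∑ j, L i j x ≤ 2 * D * ∑ i, |fderiv ℝ φ x (e i)| +
      ∑ i, ∑ j, |fderiv ℝ (fun y => fderiv ℝ φ y (e j)) x (e i)| := by
    have hs : ∑ i, ∑ j, L i j x = 2 * ((∑ i, fderiv ℝ φ x (e i) * G i x) *
        ∑ i, fderiv ℝ (G i) x (e i)) +
        ∑ i, ∑ j, fderiv ℝ (fun y => fderiv ℝ φ y (e j)) x (e i) * G i x * G j x := by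
      simp only [L, sum_add_distrib]
      congr 1
      rw [two_mul]
      congr 1
      · rw [sum_mul_sum]
      · rw [sum_comm, sum_mul_sum]
        exact sum_congr rfl fun i _ => sum_congr rfl fun j _ => by ring
    rw [hs, mul_assoc]
    have hb : ∑ i, fderiv ℝ φ x (e i) * G i x ≤ ∑ i, |fderiv ℝ φ x (e i)| :=
      sum_le_sum fun i _ => by
        refine (le_abs_self _).trans ?_
        rw [abs_mul]
        exact mul_le_of_le_one_right (abs_nonneg _) (hG1 i x)
    refine add_le_add (mul_le_mul_of_nonneg_left ?_ zero_le_two) ?_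
    · calc _ ≤ (∑ i, |fderiv ℝ φ x (e i)|) * ∑ i, fderiv ℝ (G i) x (e i) :=
            mul_le_mul_of_nonneg_right hb (hd0 x)
        _ ≤ _ := by
            rw [mul_comm]
            exact mul_le_mul_of_nonneg_right (hdD x) (sum_nonneg fun _ _ => abs_nonneg _)
    · refine sum_le_sum fun i _ => sum_le_sum fun j _ => (le_abs_self _).trans ?_
      rw [abs_mul, abs_mul]
      exact (mul_le_of_le_one_right (by positivity) (hG1 j x)).trans
        (mul_le_of_le_one_right (abs_nonneg _) (hG1 i x))
  calc A * ∫ x, φ x ∂μ = ∫ x, φ x * A ∂μ := by rw [integral_mul_const, mul_comm]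
    _ = ∫ x, ∑ i, ∑ j, L i j x ∂μ + ∫ x, φ x * (∑ i, fderiv ℝ (G i) x (e i)) ^ 2 ∂μ := by
        simp only [hJ]
        rw [integral_add
          (integrable_finsetSum _ fun i _ => integrable_finsetSum _ fun j _ => iJ i j)
          i4, hJL]
    _ ≤ ∫ x, (2 * D * ∑ i, |fderiv ℝ φ x (e i)| +
          ∑ i, ∑ j, |fderiv ℝ (fun y => fderiv ℝ φ y (e j)) x (e i)|) ∂μ +
        D * ∫ x, ∑ i, |fderiv ℝ φ x (e i)| ∂μ :=
        add_le_add (integral_mono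
          (integrable_finsetSum _ fun i _ => integrable_finsetSum _ fun j _ => iL i j)
          ((i1s.const_mul _).add i2s) hL) hsq
    _ = _ := by
        rw [integral_add (i1s.const_mul _) i2s, integral_const_mul]
        ring

/-- A bounded `C¹` vector field on the whole space whose divergence is nonnegative and bounded
cannot have `tr ((DF)²)` equal to a positive constant. -/
theorem trace_sq_fderiv_nonpos {ι : Type*} [Fintype ι] (e : ι → E)
    {F : ι → E → ℝ} (hF : ∀ i, ContDiff ℝ 1 (F i)) (hF1 : ∀ i x, |F i x| ≤ 1) {a D : ℝ}
    (ha : ∀ x, ∑ i, ∑ j, fderiv ℝ (F i) x (e j) * fderiv ℝ (F j) x (e i) = a)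
    (hd0 : ∀ x, 0 ≤ ∑ i, fderiv ℝ (F i) x (e i))
    (hdD : ∀ x, ∑ i, fderiv ℝ (F i) x (e i) ≤ D) : a ≤ 0 := by
  let μ : Measure E := MeasureTheory.Measure.addHaar
  let φ : ContDiffBump (0 : E) := ⟨1, 2, one_pos, one_lt_two⟩
  have hI : 0 < ∫ x, φ x ∂μ := φ.integral_pos
  set I := ∫ x, φ x ∂μ
  set C₁ := 3 * ∫ x, ∑ i, |fderiv ℝ φ x (e i)| ∂μ
  set C₂ := ∫ x, ∑ i, ∑ j, |fderiv ℝ (fun y => fderiv ℝ φ y (e j)) x (e i)| ∂μ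
  have hC₁0 : 0 ≤ C₁ :=
    mul_nonneg (by norm_num) (integral_nonneg fun x => sum_nonneg fun _ _ => abs_nonneg _)
  have hC₂0 : 0 ≤ C₂ :=
    integral_nonneg fun x => sum_nonneg fun _ _ => sum_nonneg fun _ _ => abs_nonneg _
  have hD0 : 0 ≤ D := (hd0 0).trans (hdD 0)
  have key (r : ℝ) (hr : 0 < r) : r ^ 2 * a * I ≤ r * D * C₁ + C₂ := by
    have hfd (i : ι) (x v : E) :
        fderiv ℝ (fun y => F i (r • y)) x v = r * fderiv ℝ (F i) (r • x) v := by
      rw [fderiv_comp_smul]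
      simp
    refine mul_integral_le_of_trace_sq_const μ φ.contDiff φ.hasCompactSupport
      (fun x => φ.nonneg) e (G := fun i x => F i (r • x))
      (fun i => (hF i).comp (contDiff_const.smul contDiff_id)) (fun i x => hF1 i _) ?_ ?_ ?_
    · intro x
      rw [← ha (r • x), mul_sum]
      refine sum_congr rfl fun i _ => ?_
      rw [mul_sum]
      refine sum_congr rfl fun j _ => ?_
      rw [hfd, hfd]
      ring
    · intro x
      simp only [hfd, ← mul_sum]
      exact mul_nonneg hr.le (hd0 _)
    · intro x
      simp only [hfd, ← mul_sum]
      exact mul_le_mul_of_nonneg_left (hdD _) hr.le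
  by_contra! hpos
  have haI : 0 < a * I := mul_pos hpos hI
  set r := (D * C₁ + C₂) / (a * I) + 1
  have hr : 1 ≤ r := le_add_of_nonneg_left (by positivity)
  have h1 := key r (by linarith)
  have h2 : r * (a * I) = D * C₁ + C₂ + a * I := by
    simp only [r]
    field_simp
  nlinarith

end Integration

section MatrixAlgebra

open Matrix

variable {ι : Type*} [Fintype ι]

theorem trace_sq_le_card_mul_trace_mul_self {S : Matrix ι ι ℝ} (hS : Sᵀ = S) :
    S.trace ^ 2 ≤ Fintype.card ι * (S * S).trace := by
  have h : (S * S).trace = ∑ i, ∑ j, S i j ^ 2 := by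
    simp only [trace, diag_apply, mul_apply]
    refine sum_congr rfl fun i _ => sum_congr rfl fun j _ => ?_
    rw [pow_two, ← congrFun (congrFun hS j) i, transpose_apply]
  rw [h]
  refine (sq_sum_le_card_mul_sum_sq (s := univ) (f := fun i => S i i)).trans ?_
  refine mul_le_mul_of_nonneg_left (sum_le_sum fun i _ => ?_) (Nat.cast_nonneg _)
  exact single_le_sum (f := fun j => S i j ^ 2) (fun j _ => sq_nonneg _) (mem_univ i)

variable [DecidableEq ι]

theorem one_sub_smul_vecMulVec_mul (p : ι → ℝ) (a b : ℝ) :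
    ((1 : Matrix ι ι ℝ) - a • vecMulVec p p) * (1 - b • vecMulVec p p) =
      1 - (a + b - a * b * (p ⬝ᵥ p)) • vecMulVec p p := by
  rw [sub_mul, mul_sub, mul_sub, Matrix.one_mul, Matrix.mul_one, Matrix.one_mul,
    smul_mul_smul_comm, vecMulVec_mul_vecMulVec, vecMulVec_smul]
  module

/-- The product of the inverse metric of a graph with a symmetric matrix is similar to a
symmetric matrix; this records the consequences for traces. -/
theorem exists_symm_of_inverse_metric_mul (p : ι → ℝ) {h : Matrix ι ι ℝ} (hh : hᵀ = h) :
    ∃ S : Matrix ι ι ℝ, Sᵀ = S ∧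
      ((1 - (1 + p ⬝ᵥ p)⁻¹ • vecMulVec p p) * h).trace = S.trace ∧
      ((1 - (1 + p ⬝ᵥ p)⁻¹ • vecMulVec p p) * h *
        ((1 - (1 + p ⬝ᵥ p)⁻¹ • vecMulVec p p) * h)).trace = (S * S).trace ∧
      (S = 0 → h = 0) := by
  set q := p ⬝ᵥ p with hq
  have hq0 : 0 ≤ q := sum_nonneg fun i _ => mul_self_nonneg (p i)
  set w := Real.sqrt (1 + q)
  have hw : 0 < w := Real.sqrt_pos.2 (by linarith)
  have hw2 : w ^ 2 = 1 + q := Real.sq_sqrt (by linarith)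
  set Q : Matrix ι ι ℝ := 1 - (w * (w + 1))⁻¹ • vecMulVec p p with hQ
  have hQt : Qᵀ = Q := by simp [hQ, transpose_vecMulVec]
  have hP : 1 - (1 + q)⁻¹ • vecMulVec p p = Q * Q := by
    rw [hQ, one_sub_smul_vecMulVec_mul, ← hw2, ← hq, show q = w ^ 2 - 1 by linarith]
    congr 2
    field_simp
    ring
  set G : Matrix ι ι ℝ := 1 - (-1 : ℝ) • vecMulVec p p with hG
  have hq1 : 1 + q ≠ 0 := by positivity
  have hGP : G * (Q * Q) = 1 := by
    rw [← hP, hG, one_sub_smul_vecMulVec_mul, ← hq]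
    have : -1 + (1 + q)⁻¹ - -1 * (1 + q)⁻¹ * q = 0 := by field_simp; ring
    rw [this, zero_smul, sub_zero]
  have hPG : (Q * Q) * G = 1 := mul_eq_one_comm.1 hGP
  refine ⟨Q * h * Q, by simp [hQt, hh, Matrix.mul_assoc], ?_, ?_, fun h0 => ?_⟩
  · rw [hP, trace_mul_comm (Q * h), Matrix.mul_assoc]
  · rw [hP, trace_mul_comm (Q * h * Q), Matrix.mul_assoc Q Q h, Matrix.mul_assoc Q (Q * h),
      trace_mul_comm Q]
    simp only [Matrix.mul_assoc]
  · calc h = (G * (Q * Q)) * h * ((Q * Q) * G) := by rw [hGP, hPG, one_mul, mul_one]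
      _ = G * Q * (Q * h * Q) * (Q * G) := by simp only [Matrix.mul_assoc]
      _ = 0 := by rw [h0]; simp

end MatrixAlgebra

section Graph

variable {n : ℕ} {f : EuclideanSpace ℝ (Fin n) → ℝ}

theorem gradSq_nonneg (x : EuclideanSpace ℝ (Fin n)) : 0 ≤ gradSq n f x :=
  sum_nonneg fun _ _ => sq_nonneg _

theorem hess_transpose (hf : ContDiff ℝ 2 f) (x : EuclideanSpace ℝ (Fin n)) :
    (hess n f x).transpose = hess n f x := by
  have hd : DifferentiableAt ℝ (fderiv ℝ f) x :=
    (hf.fderiv_right (m := 1) (by norm_num)).differentiable one_ne_zero x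
  have hsym : IsSymmSndFDerivAt ℝ f x := hf.contDiffAt.isSymmSndFDerivAt (by simp)
  ext i j
  simp only [hess, Matrix.transpose_apply, Matrix.of_apply]
  rw [fderiv_clm_apply hd (differentiableAt_const _), fderiv_clm_apply hd (differentiableAt_const _)]
  simpa using hsym.eq _ _

/-- The components of `∇f / √(1 + |∇f|²)`, the horizontal part of the downward unit normal. -/
noncomputable def unitNormalCoord (n : ℕ) (f : EuclideanSpace ℝ (Fin n) → ℝ) (i : Fin n)
    (x : EuclideanSpace ℝ (Fin n)) : ℝ :=
  grad n f x i / Real.sqrt (1 + gradSq n f x)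

theorem contDiff_grad (hf : ContDiff ℝ 2 f) (i : Fin n) : ContDiff ℝ 1 fun x => grad n f x i :=
  contDiff_fderiv_apply_const hf _

theorem contDiff_unitNormalCoord (hf : ContDiff ℝ 2 f) (i : Fin n) :
    ContDiff ℝ 1 (unitNormalCoord n f i) := by
  have h1 (x : EuclideanSpace ℝ (Fin n)) : 0 < 1 + gradSq n f x := by
    linarith [gradSq_nonneg (f := f) x]
  refine (contDiff_grad hf i).div (ContDiff.sqrt ?_ fun x => (h1 x).ne')
    fun x => (Real.sqrt_pos.2 (h1 x)).ne'
  exact contDiff_const.add (ContDiff.sum fun k _ => (contDiff_grad hf k).pow 2)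

theorem abs_unitNormalCoord_le_one (i : Fin n) (x : EuclideanSpace ℝ (Fin n)) :
    |unitNormalCoord n f i x| ≤ 1 := by
  rw [unitNormalCoord, abs_div, abs_of_nonneg (Real.sqrt_nonneg _)]
  refine div_le_one_of_le₀ (Real.abs_le_sqrt ?_) (Real.sqrt_nonneg _)
  have := single_le_sum (f := fun k => grad n f x k ^ 2) (fun k _ => sq_nonneg _) (mem_univ i)
  simp only [gradSq]
  linarith

theorem fderiv_unitNormalCoord (hf : ContDiff ℝ 2 f) (i j : Fin n)
    (x : EuclideanSpace ℝ (Fin n)) :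
    fderiv ℝ (unitNormalCoord n f i) x (EuclideanSpace.single j 1) = shapeOp n f x i j := by
  set v : EuclideanSpace ℝ (Fin n) := EuclideanSpace.single j 1
  have hp (k : Fin n) : HasDerivAt (fun t : ℝ => grad n f (x + t • v) k) (hess n f x k j) 0 := by
    have := hasDerivAt_comp_add_smul (contDiff_grad hf k) x v 0
    rw [← hess_transpose hf x]
    rw [zero_smul, add_zero] at this
    exact this
  have hq : HasDerivAt (fun t : ℝ => 1 + gradSq n f (x + t • v))
      (2 * ∑ k, grad n f x k * hess n f x k j) 0 := by
    have := (HasDerivAt.fun_sum fun k (_ : k ∈ univ) => (hp k).pow 2).const_add 1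
    refine this.congr_deriv ?_
    rw [mul_sum]
    refine sum_congr rfl fun k _ => ?_
    simp only [zero_smul, add_zero, Nat.cast_ofNat, Nat.reduceSub, pow_one]
    ring
  have hpos : 0 < 1 + gradSq n f x := by linarith [gradSq_nonneg (f := f) x]
  have hw : 0 < Real.sqrt (1 + gradSq n f x) := Real.sqrt_pos.2 hpos
  have hF := (hp i).div (hq.sqrt (by simpa using hpos.ne')) (by simpa using hw.ne')
  have hF' := hasDerivAt_comp_add_smul (contDiff_unitNormalCoord hf i) x v 0
  have hval := hF'.unique hF
  rw [zero_smul, add_zero] at hval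
  have hW : shapeOp n f x i j = (Real.sqrt (1 + gradSq n f x))⁻¹ *
      (hess n f x i j - grad n f x i * (∑ k, grad n f x k * hess n f x k j) /
        (1 + gradSq n f x)) := by
    simp only [shapeOp, Matrix.smul_apply, sub_mul, one_mul, Matrix.sub_apply, Matrix.mul_apply,
      Matrix.of_apply, smul_eq_mul]
    congr 2
    rw [mul_sum, sum_div]
    exact sum_congr rfl fun k _ => by ring
  rw [hW, hval]
  have hsq := Real.sq_sqrt hpos.le
  set w := Real.sqrt (1 + gradSq n f x)
  rw [← hsq]
  field_simp

/-- Pointwise algebra of the shape operator: it is similar to a symmetric matrix. -/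
theorem shapeOp_trace (hf : ContDiff ℝ 2 f) (x : EuclideanSpace ℝ (Fin n)) :
    0 ≤ (shapeOp n f x * shapeOp n f x).trace ∧
      (shapeOp n f x).trace ^ 2 ≤ n * (shapeOp n f x * shapeOp n f x).trace ∧
      ((shapeOp n f x * shapeOp n f x).trace = 0 → hess n f x = 0) := by
  obtain ⟨S, hS, h1, h2, h3⟩ := exists_symm_of_inverse_metric_mul (grad n f x) (hess_transpose hf x)
  have hpos : 0 < 1 + gradSq n f x := by linarith [gradSq_nonneg (f := f) x]
  have hq : dotProduct (grad n f x) (grad n f x) = gradSq n f x :=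
    sum_congr rfl fun i _ => (pow_two _).symm
  have hw : 0 < (Real.sqrt (1 + gradSq n f x))⁻¹ := inv_pos.2 (Real.sqrt_pos.2 hpos)
  set s := (Real.sqrt (1 + gradSq n f x))⁻¹
  have hW : shapeOp n f x = s • ((1 - (1 + gradSq n f x)⁻¹ •
      Matrix.vecMulVec (grad n f x) (grad n f x)) * hess n f x) := by
    rw [shapeOp]
    congr 3
    ext i j
    simp [Matrix.vecMulVec_apply, div_eq_inv_mul]
  rw [hq] at h1 h2
  rw [hW, smul_mul_smul_comm, Matrix.trace_smul, Matrix.trace_smul, h1, h2, smul_eq_mul,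
    smul_eq_mul]
  have hSS : (S * S).trace = (S.transpose * S).trace := by rw [hS]
  have hnn : 0 ≤ (S * S).trace := by
    rw [hSS]
    exact (Matrix.posSemidef_conjTranspose_mul_self S).trace_nonneg
  refine ⟨by positivity, ?_, fun h0 => h3 ?_⟩
  · have := mul_le_mul_of_nonneg_left (trace_sq_le_card_mul_trace_mul_self hS) (mul_pos hw hw).le
    rw [Fintype.card_fin] at this
    linarith
  · have h0' : (S * S).trace = 0 := (mul_eq_zero.1 h0).resolve_left (mul_pos hw hw).ne'
    rw [hSS] at h0'
    exact Matrix.trace_conjTranspose_mul_self_eq_zero_iff.1 h0'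

end Graph

/-- **Corollary 4.** If an entire graph in `ℝ^{n+1}` has `|A|` constant and mean
curvature that does not change sign, then it is a hyperplane: `D²f(x) = 0`
(equivalently `W(x) = 0`) for all `x`. -/
theorem entire_graph_is_hyperplane_of_constant_normA_and_meanCurv_sign
    (n : ℕ) (hn : 2 ≤ n)
    (f : EuclideanSpace ℝ (Fin n) → ℝ) (hf : ContDiff ℝ 2 f)
    (hA : ∃ c : ℝ, ∀ x : EuclideanSpace ℝ (Fin n), normA n f x = c)
    (hH : (∀ x : EuclideanSpace ℝ (Fin n), 0 ≤ meanCurv n f x) ∨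
          (∀ x : EuclideanSpace ℝ (Fin n), meanCurv n f x ≤ 0)) :
    ∀ x : EuclideanSpace ℝ (Fin n), hess n f x = 0 := by
  obtain ⟨c, hc⟩ := hA
  have htr (x : EuclideanSpace ℝ (Fin n)) : (shapeOp n f x * shapeOp n f x).trace = c ^ 2 := by
    rw [← hc x, normA, Real.sq_sqrt (shapeOp_trace hf x).1]
  have hbound (x : EuclideanSpace ℝ (Fin n)) : |(shapeOp n f x).trace| ≤ Real.sqrt (n * c ^ 2) :=
    Real.abs_le_sqrt (htr x ▸ (shapeOp_trace hf x).2.1)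
  have hn0 : (0 : ℝ) < n := by exact_mod_cast (by omega : 0 < n)
  have hfd := fderiv_unitNormalCoord hf
  suffices hc0 : c ^ 2 ≤ 0 from fun x =>
    (shapeOp_trace hf x).2.2 ((htr x).trans (le_antisymm hc0 (sq_nonneg c)))
  rcases hH with hH | hH
  · refine trace_sq_fderiv_nonpos (fun j : Fin n => EuclideanSpace.single j (1 : ℝ))
      (contDiff_unitNormalCoord hf) abs_unitNormalCoord_le_one (D := Real.sqrt (n * c ^ 2))
      (fun x => ?_) (fun x => ?_) (fun x => ?_)
    · simp only [hfd]
      exact htr x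
    · simp only [hfd]
      have h : 0 ≤ (shapeOp n f x).trace := by
        by_contra! hlt
        exact absurd (hH x) (not_le.2 (div_neg_of_neg_of_pos hlt hn0))
      exact h
    · simp only [hfd]
      exact (le_abs_self _).trans (hbound x)
  · have hneg (i j : Fin n) (x : EuclideanSpace ℝ (Fin n)) :
        fderiv ℝ (fun y => -unitNormalCoord n f i y) x (EuclideanSpace.single j 1) =
          -shapeOp n f x i j := by
      rw [fderiv_fun_neg, neg_apply, hfd]
    refine trace_sq_fderiv_nonpos (fun j : Fin n => EuclideanSpace.single j (1 : ℝ))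
      (F := fun i x => -unitNormalCoord n f i x)
      (fun i => (contDiff_unitNormalCoord hf i).neg)
      (fun i x => (abs_neg _).trans_le (abs_unitNormalCoord_le_one i x))
      (D := Real.sqrt (n * c ^ 2)) (fun x => ?_) (fun x => ?_) (fun x => ?_)
    · simp only [hneg, neg_mul_neg]
      exact htr x
    · simp only [hneg, sum_neg_distrib]
      have h : (shapeOp n f x).trace ≤ 0 := by
        by_contra! hlt
        exact absurd (hH x) (not_le.2 (div_pos hlt hn0))
      exact neg_nonneg.2 h
    · simp only [hneg, sum_neg_distrib]
      exact (neg_le_abs _).trans (hbound x)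
end
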